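/- arXiv:1705.07229 — 6 statements merged into one kernel-verified Lean document; each statement's English description precedes it below -/
import Mathlib

section
/- Suppose i ∈ {1,…,p}, k ≥ 1, x_j^{k−1} ∈ dom f_j for all j, w_i^k ∈ D_{Z_i}(m_i,M_i) with Z_i := dom f_i, and x_i^k is a global minimizer over ℝ^{n_i} of x_i ↦ L_β(x_1^{k−1},…,x_{i−1}^{k−1}, x_i, x_{i+1}^{k−1},…,x_p^{k−1}, λ^{k−1}) + (dw_i^k)(x_i; x_i^{k−1}). Then L_β(x_1^{k−1},…,x_{i−1}^{k−1}, x_i^k, x_{i+1}^{k−1},…,x_p^{k−1}, λ^{k−1}) − L_β(x_1^{k−1},…,x_p^{k−1}, λ^{k−1}) ≤ −(m_i/2)‖x_i^k − x_i^{k−1}‖². -/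
open scoped RealInnerProductSpace
open Finset ContinuousLinearMap

/-- The augmented Lagrangian `L_β(x₁,…,x_p,λ)` of the linearly constrained problem
`min Σ fᵢ(xᵢ) s.t. Σ Aᵢ xᵢ = b`, with the convention that the `fᵢ` are the real-valued
restrictions of the extended-real-valued objective functions to their domains. -/
noncomputable def augL {d p : ℕ} {n : Fin p → ℕ}
    (f : ∀ i, EuclideanSpace ℝ (Fin (n i)) → ℝ)
    (A : ∀ i, EuclideanSpace ℝ (Fin (n i)) →L[ℝ] EuclideanSpace ℝ (Fin d))
    (b : EuclideanSpace ℝ (Fin d)) (β : ℝ)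
    (x : ∀ i, EuclideanSpace ℝ (Fin (n i))) (lam : EuclideanSpace ℝ (Fin d)) : ℝ :=
  (∑ i, f i (x i)) - ⟪lam, (∑ i, A i (x i)) - b⟫ + β / 2 * ‖(∑ i, A i (x i)) - b‖ ^ 2

/-- The Bregman distance `(dw)(z'; z) := w(z') − w(z) − ⟨∇w(z), z' − z⟩`. -/
noncomputable def breg {E : Type*} [NormedAddCommGroup E] [InnerProductSpace ℝ E]
    [CompleteSpace E] (w : E → ℝ) (z' z : E) : ℝ :=
  w z' - w z - ⟪gradient w z, z' - z⟫

/-- `w ∈ D_Z(m, M)`: `w` is differentiable on `Z`, `m`-strongly convex on `Z` and its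
gradient is `M`-Lipschitz on `Z`. -/
def memD {E : Type*} [NormedAddCommGroup E] [InnerProductSpace ℝ E] [CompleteSpace E]
    (Z : Set E) (m M : ℝ) (w : E → ℝ) : Prop :=
  (∀ z ∈ Z, DifferentiableAt ℝ w z) ∧
  (∀ z ∈ Z, ∀ z' ∈ Z, m / 2 * ‖z - z'‖ ^ 2 ≤ w z' - w z - ⟪gradient w z, z' - z⟫) ∧
  (∀ z ∈ Z, ∀ z' ∈ Z, ‖gradient w z - gradient w z'‖ ≤ M * ‖z - z'‖)

/-- if `x_i^k` is a global minimizer of the `i`-th NEPJ-ADMM subproblem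
(over the domain of `f_i`) with `w_i^k ∈ D_{Z_i}(m_i, M_i)`, then
`L_β(x_{<i}^{k−1}, x_i^k, x_{>i}^{k−1}, λ^{k−1}) − L_β(x^{k−1}, λ^{k−1}) ≤ −(m_i/2)‖x_i^k − x_i^{k−1}‖²`. -/
theorem subproblem_decrease
    {d q : ℕ} {n : Fin (q + 1) → ℕ}
    (f : ∀ i, EuclideanSpace ℝ (Fin (n i)) → ℝ)
    (Z : ∀ i, Set (EuclideanSpace ℝ (Fin (n i))))
    (A : ∀ i, EuclideanSpace ℝ (Fin (n i)) →L[ℝ] EuclideanSpace ℝ (Fin d))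
    (b : EuclideanSpace ℝ (Fin d)) (β : ℝ) (hβ : 0 < β)
    (m M : Fin (q + 1) → ℝ) (hmM : ∀ i, m i ≤ M i)
    (i : Fin (q + 1))
    (xprev : ∀ j, EuclideanSpace ℝ (Fin (n j)))
    (hxprev : ∀ j, xprev j ∈ Z j)
    (lamprev : EuclideanSpace ℝ (Fin d))
    (wi : EuclideanSpace ℝ (Fin (n i)) → ℝ)
    (hwi : memD (Z i) (m i) (M i) wi)
    (xi : EuclideanSpace ℝ (Fin (n i)))
    (hxiZ : xi ∈ Z i)
    (hmin : ∀ y ∈ Z i,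
      augL f A b β (Function.update xprev i xi) lamprev + breg wi xi (xprev i)
        ≤ augL f A b β (Function.update xprev i y) lamprev + breg wi y (xprev i)) :
    augL f A b β (Function.update xprev i xi) lamprev - augL f A b β xprev lamprev
      ≤ -(m i / 2) * ‖xi - xprev i‖ ^ 2 := by
  have hdec := hmin (xprev i) (hxprev i)
  have hconv := hwi.2.1 (xprev i) (hxprev i) xi hxiZ
  rw [norm_sub_rev] at hconv
  simp only [Function.update_eq_self, breg, sub_self, inner_zero_right] at hdec
  linarith
end

section
/- For every k ≥ 1, the NEPJ-ADMM iterates satisfy L_β(x^k,λ^k) − L_β(x^{k−1},λ^{k−1}) ≤ Σ_{1≤j<i≤p} β⟨A_iΔx_i^k, A_jΔx_j^k⟩ − Σ_{i=1}^p (m_i/2)‖Δx_i^k‖² + (1/(θβ))‖Δλ^k‖². -/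
open scoped RealInnerProductSpace
open Finset ContinuousLinearMap

/-- Changing the `i`-th block changes a separable sum by the difference of the `i`-th terms. -/
theorem sum_apply_update {ι : Type*} [Fintype ι] [DecidableEq ι] {E : ι → Type*} {F : Type*}
    [AddCommGroup F] (g : ∀ i, E i → F) (x : ∀ i, E i) (i : ι) (y : E i) :
    ∑ j, g j (Function.update x i y j) = (∑ j, g j (x j)) + (g i y - g i (x i)) := by
  rw [← sub_eq_iff_eq_add', ← Finset.sum_sub_distrib, Finset.sum_eq_single i]
  · simp
  · intro j _ hj
    simp [Function.update_of_ne hj]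
  · simp

/-- The squared norm of a sum is the sum of the squared norms plus twice the sum of the
inner products over ordered pairs. -/
theorem norm_sum_sq_eq_sum_add_two_mul {ι F : Type*} [Fintype ι] [LinearOrder ι]
    [LocallyFiniteOrderBot ι] [NormedAddCommGroup F] [InnerProductSpace ℝ F] (a : ι → F) :
    ‖∑ i, a i‖ ^ 2 = (∑ i, ‖a i‖ ^ 2) + 2 * ∑ i, ∑ j ∈ Finset.Iio i, ⟪a i, a j⟫ := by
  have hIio : ∀ i, ∑ j ∈ Finset.Iio i, ⟪a i, a j⟫ = ∑ j, if j < i then ⟪a i, a j⟫ else 0 := by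
    intro i
    rw [← Finset.sum_filter]
    congr 1
    ext j
    simp
  have hswap : ∑ i, ∑ j, (if i < j then ⟪a i, a j⟫ else 0)
      = ∑ i, ∑ j, (if j < i then ⟪a i, a j⟫ else 0) := by
    rw [Finset.sum_comm]
    simp only [real_inner_comm]
  have hsplit : ∀ i, ∑ j, ⟪a i, a j⟫ = ‖a i‖ ^ 2
      + (∑ j, if j < i then ⟪a i, a j⟫ else 0) + ∑ j, if i < j then ⟪a i, a j⟫ else 0 := by
    intro i
    have hdiag : ‖a i‖ ^ 2 = ∑ j, if i = j then ⟪a i, a j⟫ else 0 := by simp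
    rw [hdiag, ← Finset.sum_add_distrib, ← Finset.sum_add_distrib]
    refine Finset.sum_congr rfl fun j _ => ?_
    rcases lt_trichotomy i j with h | h | h
    · simp [h, h.ne, h.not_gt]
    · simp [h]
    · simp [h, h.ne', h.not_gt]
  rw [← real_inner_self_eq_norm_sq, sum_inner]
  simp only [inner_sum, hsplit, hIio, Finset.sum_add_distrib, hswap]
  ring

/-- Effect on the augmented Lagrangian of changing a single block. -/
theorem augL_update {d p : ℕ} {n : Fin p → ℕ}
    (f : ∀ i, EuclideanSpace ℝ (Fin (n i)) → ℝ)
    (A : ∀ i, EuclideanSpace ℝ (Fin (n i)) →L[ℝ] EuclideanSpace ℝ (Fin d))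
    (b : EuclideanSpace ℝ (Fin d)) (β : ℝ)
    (x : ∀ i, EuclideanSpace ℝ (Fin (n i))) (lam : EuclideanSpace ℝ (Fin d))
    (i : Fin p) (y : EuclideanSpace ℝ (Fin (n i))) :
    augL f A b β (Function.update x i y) lam = augL f A b β x lam
      + (f i y - f i (x i)) - ⟪lam, A i (y - x i)⟫
      + β * ⟪(∑ j, A j (x j)) - b, A i (y - x i)⟫ + β / 2 * ‖A i (y - x i)‖ ^ 2 := by
  have hA : (∑ j, A j (Function.update x i y j)) - b
      = ((∑ j, A j (x j)) - b) + A i (y - x i) := by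
    rw [sum_apply_update (fun j => A j) x i y, map_sub]
    abel
  unfold augL
  rw [sum_apply_update f x i y, hA, norm_add_sq_real, inner_add_right]
  ring

/-- Effect on the augmented Lagrangian of changing all blocks simultaneously. -/
theorem augL_eq_add_sum {d p : ℕ} {n : Fin p → ℕ}
    (f : ∀ i, EuclideanSpace ℝ (Fin (n i)) → ℝ)
    (A : ∀ i, EuclideanSpace ℝ (Fin (n i)) →L[ℝ] EuclideanSpace ℝ (Fin d))
    (b : EuclideanSpace ℝ (Fin d)) (β : ℝ)
    (x y : ∀ i, EuclideanSpace ℝ (Fin (n i))) (lam : EuclideanSpace ℝ (Fin d)) :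
    augL f A b β y lam = augL f A b β x lam
      + (∑ i, (augL f A b β (Function.update x i (y i)) lam - augL f A b β x lam))
      + ∑ i, ∑ j ∈ Finset.Iio i, β * ⟪A i (y i - x i), A j (y j - x j)⟫ := by
  have hA : (∑ i, A i (y i)) - b
      = ((∑ i, A i (x i)) - b) + ∑ i, A i (y i - x i) := by
    simp only [map_sub, Finset.sum_sub_distrib]
    abel
  have hsum : ∑ i, (augL f A b β (Function.update x i (y i)) lam - augL f A b β x lam)
      = (∑ i, f i (y i)) - (∑ i, f i (x i)) - ⟪lam, ∑ i, A i (y i - x i)⟫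
        + β * ⟪(∑ i, A i (x i)) - b, ∑ i, A i (y i - x i)⟫
        + β / 2 * ∑ i, ‖A i (y i - x i)‖ ^ 2 := by
    rw [inner_sum, inner_sum, Finset.mul_sum, Finset.mul_sum, ← Finset.sum_sub_distrib,
      ← Finset.sum_sub_distrib, ← Finset.sum_add_distrib, ← Finset.sum_add_distrib]
    refine Finset.sum_congr rfl fun i _ => ?_
    rw [augL_update]
    ring
  rw [hsum]
  unfold augL
  rw [hA, norm_add_sq_real, inner_add_right, norm_sum_sq_eq_sum_add_two_mul]
  simp only [← Finset.mul_sum]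
  ring

/-- Effect on the augmented Lagrangian of a dual step of length `c` along the residual. -/
theorem augL_dual_step {d p : ℕ} {n : Fin p → ℕ}
    (f : ∀ i, EuclideanSpace ℝ (Fin (n i)) → ℝ)
    (A : ∀ i, EuclideanSpace ℝ (Fin (n i)) →L[ℝ] EuclideanSpace ℝ (Fin d))
    (b : EuclideanSpace ℝ (Fin d)) (β : ℝ) {c : ℝ}
    (x : ∀ i, EuclideanSpace ℝ (Fin (n i))) {lam mu : EuclideanSpace ℝ (Fin d)}
    (h : mu = lam - c • ((∑ i, A i (x i)) - b)) :
    augL f A b β x mu = augL f A b β x lam + 1 / c * ‖mu - lam‖ ^ 2 := by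
  subst h
  unfold augL
  rw [inner_sub_left, real_inner_smul_left, real_inner_self_eq_norm_sq, sub_sub_cancel_left,
    norm_neg, norm_smul, mul_pow, Real.norm_eq_abs, sq_abs]
  field_simp
  ring

/-- Lemma `lem:auxdecL`: for every `k ≥ 1`, the NEPJ-ADMM iterates satisfy
`L_β(x^k,λ^k) − L_β(x^{k−1},λ^{k−1}) ≤ Σ_{1≤j<i≤p} β⟨A_iΔx_i^k, A_jΔx_j^k⟩
  − Σ_{i=1}^p (m_i/2)‖Δx_i^k‖² + (1/(θβ))‖Δλ^k‖²`.
Blocks are indexed by `Fin (q+1)` (so `p = q+1`), and iteration `k ≥ 1` is written `k+1`. -/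
theorem nepjadmm_augL_decrease
    {d q : ℕ} {n : Fin (q + 1) → ℕ} (hq : 1 ≤ q)
    (f : ∀ i, EuclideanSpace ℝ (Fin (n i)) → ℝ)
    (Z : ∀ i, Set (EuclideanSpace ℝ (Fin (n i))))
    (A : ∀ i, EuclideanSpace ℝ (Fin (n i)) →L[ℝ] EuclideanSpace ℝ (Fin d))
    (b : EuclideanSpace ℝ (Fin d))
    (β θ Lp α : ℝ) (m M : Fin (q + 1) → ℝ)
    (x : ℕ → ∀ i, EuclideanSpace ℝ (Fin (n i)))
    (lam : ℕ → EuclideanSpace ℝ (Fin d))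
    (w : ℕ → ∀ i, EuclideanSpace ℝ (Fin (n i)) → ℝ)
    -- basic parameter assumptions
    (hβ : 0 < β) (hθ : θ ∈ Set.Ioo (0 : ℝ) 2) (hα : 0 < α)
    (hm : ∀ i, 0 < m i) (hmM : ∀ i, m i ≤ M i)
    -- (A0): the fᵢ are proper (nonempty domain) and lower semicontinuous
    (hZne : ∀ i, (Z i).Nonempty)
    (hlsc : ∀ i, LowerSemicontinuousOn (f i) (Z i))
    -- (A2): f_p is finite everywhere and differentiable with L_p-Lipschitz gradient
    (hZlast : Z (Fin.last q) = Set.univ)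
    (hfd : ∀ u, DifferentiableAt ℝ (f (Fin.last q)) u)
    (hfl : ∀ u v, ‖gradient (f (Fin.last q)) u - gradient (f (Fin.last q)) v‖ ≤ Lp * ‖u - v‖)
    -- the NEPJ-ADMM iterations
    (hx0 : ∀ i, x 0 i ∈ Z i)
    (hw : ∀ (k : ℕ) (i : Fin (q + 1)), memD (Z i) (m i) (M i) (w (k + 1) i))
    (hxZ : ∀ (k : ℕ) (i : Fin (q + 1)), x (k + 1) i ∈ Z i)
    (hmin : ∀ (k : ℕ) (i : Fin (q + 1)), ∀ y ∈ Z i,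
      augL f A b β (Function.update (x k) i (x (k + 1) i)) (lam k)
          + breg (w (k + 1) i) (x (k + 1) i) (x k i)
        ≤ augL f A b β (Function.update (x k) i y) (lam k)
          + breg (w (k + 1) i) y (x k i))
    (hlam : ∀ k : ℕ, lam (k + 1) = lam k - (θ * β) • ((∑ i, A i (x (k + 1) i)) - b))
 :
    ∀ k : ℕ,
      augL f A b β (x (k + 1)) (lam (k + 1)) - augL f A b β (x k) (lam k)
        ≤ (∑ i, ∑ j ∈ Finset.Iio i,
              β * ⟪A i (x (k + 1) i - x k i), A j (x (k + 1) j - x k j)⟫)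
          - (∑ i, m i / 2 * ‖x (k + 1) i - x k i‖ ^ 2)
          + 1 / (θ * β) * ‖lam (k + 1) - lam k‖ ^ 2 := by
  intro k
  have hxk : ∀ i, x k i ∈ Z i := by
    cases k with
    | zero => exact hx0
    | succ k => exact hxZ k
  have hblock : ∀ i, augL f A b β (Function.update (x k) i (x (k + 1) i)) (lam k)
      - augL f A b β (x k) (lam k) ≤ -(m i / 2 * ‖x (k + 1) i - x k i‖ ^ 2) := by
    intro i
    have hle := hmin k i (x k i) (hxk i)
    have hconv := (hw k i).2.1 (x k i) (hxk i) (x (k + 1) i) (hxZ k i)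
    rw [norm_sub_rev] at hconv
    rw [Function.update_eq_self] at hle
    simp only [breg, sub_self, inner_zero_right] at hle
    linarith
  have hsum := Finset.sum_le_sum fun i (_ : i ∈ Finset.univ) => hblock i
  rw [Finset.sum_neg_distrib] at hsum
  rw [augL_dual_step f A b β (x (k + 1)) (hlam k),
    augL_eq_add_sum f A b β (x k) (x (k + 1)) (lam k)]
  linarith
end

section
/- Suppose that for each k ≥ 1, x_p^k satisfies the optimality equation ∇f_p(x_p^k) − A_p^*(λ^{k−1} − β(A_p x_p^k + Σ_{j=1}^{p−1} A_j x_j^{k−1} − b)) + Δw_p^k = 0 and λ^k = λ^{k−1} − θβ(Σ_{i=1}^p A_i x_i^k − b). Then with R_p^0 := A_p^*λ^0 − ∇f_p(x_p^0) and Δλ^0 := 0, for every k ≥ 1 one has A_p^*Δλ^k = (1−θ)A_p^*Δλ^{k−1} + θ u^k, where u^k := (∇f_p(x_p^k) − ∇f_p(x_p^{k−1})) + (R_p^k − R_p^{k−1}). -/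
open scoped RealInnerProductSpace
open Finset ContinuousLinearMap

/-- Lemma `pr:aux-new`: if for each `k ≥ 1` the last-block optimality
equation and the multiplier update hold, then with `R_p^0 := A_p^*λ^0 − ∇f_p(x_p^0)` and
`Δλ^0 := 0`, one has `A_p^*Δλ^k = (1−θ)A_p^*Δλ^{k−1} + θu^k` for every `k ≥ 1`, where
`u^k := (∇f_p(x_p^k) − ∇f_p(x_p^{k−1})) + (R_p^k − R_p^{k−1})`. -/
theorem lambda_displacement_recursion
    {d q : ℕ} {n : Fin (q + 1) → ℕ}
    (A : ∀ i, EuclideanSpace ℝ (Fin (n i)) →L[ℝ] EuclideanSpace ℝ (Fin d))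
    (b : EuclideanSpace ℝ (Fin d))
    (β θ : ℝ) (hβ : 0 < β) (hθ : θ ∈ Set.Ioo (0 : ℝ) 2)
    (fp : EuclideanSpace ℝ (Fin (n (Fin.last q))) → ℝ)
    (hfp : ∀ u, DifferentiableAt ℝ fp u)
    (wp : ℕ → EuclideanSpace ℝ (Fin (n (Fin.last q))) → ℝ)
    (hwp : ∀ (k : ℕ) u, DifferentiableAt ℝ (wp (k + 1)) u)
    (x : ℕ → ∀ i, EuclideanSpace ℝ (Fin (n i)))
    (lam : ℕ → EuclideanSpace ℝ (Fin d))
    -- the optimality equation for the last block at iteration k ≥ 1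
    (hopt : ∀ k : ℕ,
      gradient fp (x (k + 1) (Fin.last q))
        - adjoint (A (Fin.last q)) (lam k - β •
            ((A (Fin.last q)) (x (k + 1) (Fin.last q))
              + (∑ j : Fin q, A j.castSucc (x k j.castSucc)) - b))
        + (gradient (wp (k + 1)) (x (k + 1) (Fin.last q))
            - gradient (wp (k + 1)) (x k (Fin.last q))) = 0)
    -- the multiplier update
    (hlam : ∀ k : ℕ, lam (k + 1) = lam k - (θ * β) • ((∑ i, A i (x (k + 1) i)) - b))
    -- the residuals R_p^k and the conventions for k = 0
    (R : ℕ → EuclideanSpace ℝ (Fin (n (Fin.last q))))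
    (hR0 : R 0 = adjoint (A (Fin.last q)) (lam 0) - gradient fp (x 0 (Fin.last q)))
    (hR : ∀ k : ℕ, R (k + 1) =
      -(∑ j : Fin q, β • adjoint (A (Fin.last q))
          (A j.castSucc (x (k + 1) j.castSucc - x k j.castSucc)))
        + (gradient (wp (k + 1)) (x (k + 1) (Fin.last q))
            - gradient (wp (k + 1)) (x k (Fin.last q))))
    (Dl : ℕ → EuclideanSpace ℝ (Fin d))
    (hDl0 : Dl 0 = 0)
    (hDl : ∀ k : ℕ, Dl (k + 1) = lam (k + 1) - lam k) :
    ∀ k : ℕ,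
      adjoint (A (Fin.last q)) (Dl (k + 1))
        = (1 - θ) • adjoint (A (Fin.last q)) (Dl k)
          + θ • ((gradient fp (x (k + 1) (Fin.last q)) - gradient fp (x k (Fin.last q)))
              + (R (k + 1) - R k)) := by
  set T := adjoint (A (Fin.last q))
  have key : ∀ k, T (Dl (k + 1))
      = θ • (gradient fp (x (k + 1) (Fin.last q)) + R (k + 1) - T (lam k)) := by
    intro k
    have h := hopt k
    rw [hDl, hlam, hR, Fin.sum_univ_castSucc]
    simp only [map_sub, map_add, map_smul, map_sum, ← smul_sum, sum_sub_distrib] at h ⊢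
    linear_combination (norm := module) (-θ) • h
  intro k
  cases k with
  | zero =>
    rw [key, hDl0, hR0, map_zero]
    module
  | succ m =>
    have h₁ := key m
    have h₂ : T (Dl (m + 1)) = T (lam (m + 1)) - T (lam m) := by rw [hDl, map_sub]
    rw [key (m + 1)]
    linear_combination (norm := module) θ • h₂ - h₁
end

section
/- Let θ ∈ (0,2), β > 0, σ > 0 and let a, b, u be vectors in ℝ^m satisfying a = (1−θ)b + θu. Then (1/(βθσ))‖a‖² + (c_1/2)(‖a‖² − ‖b‖²) ≤ (γ_θ/(βσ))‖u‖², where γ_θ := θ/(1−|θ−1|)² and c_1 := 2|θ−1|/(βθ(1−|θ−1|)σ). -/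
/-- for `θ ∈ (0,2)`, `β > 0`, `σ > 0` and vectors `a, b, u` of `ℝ^m` with
`a = (1−θ)b + θu`, one has
`(1/(βθσ))‖a‖² + (c₁/2)(‖a‖² − ‖b‖²) ≤ (γ_θ/(βσ))‖u‖²`
where `γ_θ := θ/(1−|θ−1|)²` and `c₁ := 2|θ−1|/(βθ(1−|θ−1|)σ)`. -/
theorem relaxation_inequality
    {m : ℕ} (θ β σ : ℝ) (hθ : θ ∈ Set.Ioo (0 : ℝ) 2) (hβ : 0 < β) (hσ : 0 < σ)
    (a b u : EuclideanSpace ℝ (Fin m))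
    (h : a = (1 - θ) • b + θ • u) :
    1 / (β * θ * σ) * ‖a‖ ^ 2
        + (2 * |θ - 1| / (β * θ * (1 - |θ - 1|) * σ)) / 2 * (‖a‖ ^ 2 - ‖b‖ ^ 2)
      ≤ θ / (1 - |θ - 1|) ^ 2 / (β * σ) * ‖u‖ ^ 2 := by
  obtain ⟨hθ0, hθ2⟩ := hθ
  have ht1 : |θ - 1| < 1 := abs_lt.mpr ⟨by linarith, by linarith⟩
  have ht0 : 0 ≤ |θ - 1| := abs_nonneg _
  have hnorm : ‖a‖ ≤ |θ - 1| * ‖b‖ + θ * ‖u‖ := by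
    calc ‖a‖ ≤ ‖(1 - θ) • b‖ + ‖θ • u‖ := h ▸ norm_add_le _ _
      _ = |θ - 1| * ‖b‖ + θ * ‖u‖ := by
        rw [norm_smul, norm_smul, Real.norm_eq_abs, Real.norm_eq_abs, abs_sub_comm,
          abs_of_pos hθ0]
  generalize |θ - 1| = t at *
  have hs : 0 < 1 - t := by linarith
  have hsq : ‖a‖ ^ 2 ≤ (t * ‖b‖ + θ * ‖u‖) ^ 2 := by gcongr
  have key : 0 ≤ θ ^ 2 * ‖u‖ ^ 2 - (1 - t) * ‖a‖ ^ 2 + t * (1 - t) * ‖b‖ ^ 2 := by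
    have h₁ := mul_le_mul_of_nonneg_left hsq hs.le
    have h₂ := mul_nonneg ht0 (sq_nonneg ((1 - t) * ‖b‖ - θ * ‖u‖))
    linarith
  have hdiff : θ / (1 - t) ^ 2 / (β * σ) * ‖u‖ ^ 2 - (1 / (β * θ * σ) * ‖a‖ ^ 2
        + (2 * t / (β * θ * (1 - t) * σ)) / 2 * (‖a‖ ^ 2 - ‖b‖ ^ 2))
      = (θ ^ 2 * ‖u‖ ^ 2 - (1 - t) * ‖a‖ ^ 2 + t * (1 - t) * ‖b‖ ^ 2)
        / (β * θ * σ * (1 - t) ^ 2) := by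
    have := hs.ne'
    field_simp
    ring
  rw [← sub_nonneg, hdiff]
  positivity
end

section
/- For every k ≥ 1, ‖u^k‖² ≤ (p+1)[ L_p²‖Δx_p^k‖² + Σ_{j=1}^{p−1} β²‖A_p^*A_j‖²(‖Δx_j^k‖ + ‖Δx_j^{k−1}‖)² + M_p²(‖Δx_p^k‖ + ‖Δx_p^{k−1}‖)² ], where u^k := (∇f_p(x_p^k) − ∇f_p(x_p^{k−1})) + (R_p^k − R_p^{k−1}). -/
open scoped RealInnerProductSpace
open Finset ContinuousLinearMap

/-- Cauchy–Schwarz for a sum of `card ι + 2` vectors whose norms are bounded termwise. -/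
theorem norm_add_sum_add_sq_le {ι E : Type*} [Fintype ι] [SeminormedAddCommGroup E]
    {a c : E} {t : ι → E} {α γ : ℝ} {τ : ι → ℝ}
    (ha : ‖a‖ ≤ α) (ht : ∀ j, ‖t j‖ ≤ τ j) (hc : ‖c‖ ≤ γ) :
    ‖a + ∑ j, t j + c‖ ^ 2 ≤
      ((Fintype.card ι : ℝ) + 2) * (α ^ 2 + ∑ j, τ j ^ 2 + γ ^ 2) := by
  have hnorm : ‖a + ∑ j, t j + c‖ ≤ α + ∑ j, τ j + γ :=
    norm_add₃_le.trans (by gcongr; exact norm_sum_le_of_le _ fun j _ => ht j)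
  have hcs := sq_sum_le_card_mul_sum_sq (s := Finset.univ)
    (f := fun o : Option (Option ι) => o.elim α fun o => o.elim γ τ)
  simp only [Fintype.sum_option, Option.elim, Finset.card_univ, Fintype.card_option] at hcs
  push_cast at hcs
  calc ‖a + ∑ j, t j + c‖ ^ 2 ≤ (α + ∑ j, τ j + γ) ^ 2 := by gcongr
    _ = (α + (γ + ∑ j, τ j)) ^ 2 := by ring
    _ ≤ _ := hcs
    _ = _ := by ring

/-- second inequality of Lemma `lem:des_theta1uk`: for every `k ≥ 1`,
`‖u^k‖² ≤ (p+1)[L_p²‖Δx_p^k‖² + Σ_{j=1}^{p−1} β²‖A_p^*A_j‖²(‖Δx_j^k‖+‖Δx_j^{k−1}‖)²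
  + M_p²(‖Δx_p^k‖+‖Δx_p^{k−1}‖)²]`, with the conventions `Δx_j^0 = 0` for `j < p`,
`Δx_p^0 = R_p^0/M_p`, `R_p^0 := A_p^*λ^0 − ∇f_p(x_p^0)`. Here `p = q + 1`. -/
theorem u_norm_bound
    {d q : ℕ} {n : Fin (q + 1) → ℕ}
    (A : ∀ i, EuclideanSpace ℝ (Fin (n i)) →L[ℝ] EuclideanSpace ℝ (Fin d))
    (β Lp Mp : ℝ) (hβ : 0 < β) (hMp : 0 < Mp)
    (fp : EuclideanSpace ℝ (Fin (n (Fin.last q))) → ℝ)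
    (hfpd : ∀ z, DifferentiableAt ℝ fp z)
    (hfpl : ∀ z z', ‖gradient fp z - gradient fp z'‖ ≤ Lp * ‖z - z'‖)
    (wp : ℕ → EuclideanSpace ℝ (Fin (n (Fin.last q))) → ℝ)
    (hwpd : ∀ (k : ℕ) z, DifferentiableAt ℝ (wp (k + 1)) z)
    (hwpl : ∀ (k : ℕ) z z',
      ‖gradient (wp (k + 1)) z - gradient (wp (k + 1)) z'‖ ≤ Mp * ‖z - z'‖)
    (x : ℕ → ∀ i, EuclideanSpace ℝ (Fin (n i)))
    (lam0 : EuclideanSpace ℝ (Fin d))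
    -- the residuals R_p^k with the convention for k = 0
    (R : ℕ → EuclideanSpace ℝ (Fin (n (Fin.last q))))
    (hR0 : R 0 = adjoint (A (Fin.last q)) lam0 - gradient fp (x 0 (Fin.last q)))
    (hR : ∀ k : ℕ, R (k + 1) =
      -(∑ j : Fin q, β • adjoint (A (Fin.last q))
          (A j.castSucc (x (k + 1) j.castSucc - x k j.castSucc)))
        + (gradient (wp (k + 1)) (x (k + 1) (Fin.last q))
            - gradient (wp (k + 1)) (x k (Fin.last q))))
    -- the displacements Δx with the conventions for k = 0
    (Dx : ℕ → ∀ i, EuclideanSpace ℝ (Fin (n i)))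
    (hDx0 : ∀ i : Fin q, Dx 0 i.castSucc = 0)
    (hDx0p : Dx 0 (Fin.last q) = Mp⁻¹ • R 0)
    (hDx : ∀ (k : ℕ) (i : Fin (q + 1)), Dx (k + 1) i = x (k + 1) i - x k i)
    -- u^k := Δf_p^k + ΔR_p^k
    (u : ℕ → EuclideanSpace ℝ (Fin (n (Fin.last q))))
    (hu : ∀ k : ℕ, u (k + 1) =
      (gradient fp (x (k + 1) (Fin.last q)) - gradient fp (x k (Fin.last q)))
        + (R (k + 1) - R k)) :
    ∀ k : ℕ,
      ‖u (k + 1)‖ ^ 2 ≤ ((q : ℝ) + 2) *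
        (Lp ^ 2 * ‖Dx (k + 1) (Fin.last q)‖ ^ 2
          + (∑ j : Fin q, β ^ 2 * ‖adjoint (A (Fin.last q)) ∘L A j.castSucc‖ ^ 2
              * (‖Dx (k + 1) j.castSucc‖ + ‖Dx k j.castSucc‖) ^ 2)
          + Mp ^ 2 * (‖Dx (k + 1) (Fin.last q)‖ + ‖Dx k (Fin.last q)‖) ^ 2) := by
  -- With the conventions at `0`, every `R k` is a sum over `Dx k` plus a term of size `Mp * ‖Dx k‖`.
  have hRk : ∀ k, ∃ e, ‖e‖ ≤ Mp * ‖Dx k (Fin.last q)‖ ∧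
      R k = -(∑ j : Fin q, β • adjoint (A (Fin.last q)) (A j.castSucc (Dx k j.castSucc))) + e := by
    rintro (_ | k)
    · refine ⟨R 0, ?_, by simp [hDx0]⟩
      rw [hDx0p, norm_smul, norm_inv, Real.norm_of_nonneg hMp.le, mul_inv_cancel_left₀ hMp.ne']
    · refine ⟨_, ?_, by simp only [hDx]; exact hR k⟩
      rw [hDx]
      exact hwpl k _ _
  intro k
  obtain ⟨e, he, hRe⟩ := hRk k
  obtain ⟨e', he', hRe'⟩ := hRk (k + 1)
  have hfp := hfpl (x (k + 1) (Fin.last q)) (x k (Fin.last q))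
  rw [← hDx] at hfp
  have hblock : ∀ j : Fin q,
      ‖β • (adjoint (A (Fin.last q)) ∘L A j.castSucc) (Dx k j.castSucc - Dx (k + 1) j.castSucc)‖ ≤
        β * ‖adjoint (A (Fin.last q)) ∘L A j.castSucc‖ *
          (‖Dx (k + 1) j.castSucc‖ + ‖Dx k j.castSucc‖) := fun j => by
    rw [norm_smul, Real.norm_of_nonneg hβ.le, mul_assoc, add_comm ‖Dx (k + 1) _‖]
    gcongr
    exact le_opNorm_of_le _ (norm_sub_le _ _)
  have hee : ‖e' - e‖ ≤ Mp * (‖Dx (k + 1) (Fin.last q)‖ + ‖Dx k (Fin.last q)‖) := by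
    rw [mul_add]
    exact (norm_sub_le _ _).trans (add_le_add he' he)
  have huk : u (k + 1) =
      (gradient fp (x (k + 1) (Fin.last q)) - gradient fp (x k (Fin.last q)))
        + ∑ j : Fin q, β • (adjoint (A (Fin.last q)) ∘L A j.castSucc)
            (Dx k j.castSucc - Dx (k + 1) j.castSucc)
        + (e' - e) := by
    rw [hu, hRe, hRe']
    simp only [map_sub, smul_sub, Finset.sum_sub_distrib, comp_apply]
    abel
  rw [huk]
  simpa only [mul_pow, Fintype.card_fin] using norm_add_sum_add_sq_le hfp hblock hee
end

section
/- Suppose λ^k = λ^{k−1} − θβ(Σ_{i=1}^p A_i x_i^k − b) with β > 0, θ ∈ (0,2), and x_i^k ∈ dom f_i for all i. Then L_β(x^k, λ^k) ≥ v(β) + (1/(2βθ))(‖λ^k‖² − ‖λ^{k−1}‖² + ‖λ^k − λ^{k−1}‖²), where v(β) := inf_{(x_1,…,x_p)} { Σ_{i=1}^p f_i(x_i) + (β/2)‖Σ_{i=1}^p A_i x_i − b‖² }. -/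
open scoped RealInnerProductSpace
open Finset ContinuousLinearMap

/-- If `u = v - c • r`, then `-⟪u, r⟫` is a difference of squared norms. -/
lemma neg_inner_eq_of_eq_sub_smul {E : Type*} [NormedAddCommGroup E] [InnerProductSpace ℝ E]
    {u v r : E} {c : ℝ} (hc : c ≠ 0) (h : u = v - c • r) :
    -⟪u, r⟫ = 1 / (2 * c) * (‖u‖ ^ 2 - ‖v‖ ^ 2 + ‖u - v‖ ^ 2) := by
  obtain rfl : v = u + c • r := by rw [h, sub_add_cancel]
  rw [norm_add_sq_real, sub_add_cancel_left, norm_neg, real_inner_smul_right]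
  field_simp
  ring

/-- key inequality in the proof of Proposition `prop:decL`(b): if
`λ^k = λ^{k−1} − θβ(Σ_i A_i x_i^k − b)` with `β > 0`, `θ ∈ (0,2)`, and `x_i^k ∈ dom f_i`
for all `i`, then `L_β(x^k,λ^k) ≥ v(β) + (1/(2βθ))(‖λ^k‖² − ‖λ^{k−1}‖² + ‖λ^k − λ^{k−1}‖²)`,
the inequality being understood in the extended reals. -/
theorem augL_lower_bound_step
    {d q : ℕ} {n : Fin (q + 1) → ℕ}
    (f : ∀ i, EuclideanSpace ℝ (Fin (n i)) → ℝ)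
    (Z : ∀ i, Set (EuclideanSpace ℝ (Fin (n i))))
    (A : ∀ i, EuclideanSpace ℝ (Fin (n i)) →L[ℝ] EuclideanSpace ℝ (Fin d))
    (b : EuclideanSpace ℝ (Fin d))
    (β θ : ℝ) (hβ : 0 < β) (hθ : θ ∈ Set.Ioo (0 : ℝ) 2)
    (hZne : ∀ i, (Z i).Nonempty)
    (xk : ∀ i, EuclideanSpace ℝ (Fin (n i)))
    (hxk : ∀ i, xk i ∈ Z i)
    (lamk lamprev : EuclideanSpace ℝ (Fin d))
    (hlam : lamk = lamprev - (θ * β) • ((∑ i, A i (xk i)) - b))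
    (vE : EReal)
    (hvE : vE = ⨅ z : {z : ∀ i, EuclideanSpace ℝ (Fin (n i)) // ∀ i, z i ∈ Z i},
      (((∑ i, f i (z.1 i)) + β / 2 * ‖(∑ i, A i (z.1 i)) - b‖ ^ 2 : ℝ) : EReal)) :
    vE + ((1 / (2 * β * θ)
        * (‖lamk‖ ^ 2 - ‖lamprev‖ ^ 2 + ‖lamk - lamprev‖ ^ 2) : ℝ) : EReal)
      ≤ ((augL f A b β xk lamk : ℝ) : EReal) := by
  have hinner := neg_inner_eq_of_eq_sub_smul (mul_pos hθ.1 hβ).ne' hlam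
  have hv : vE ≤ (((∑ i, f i (xk i)) + β / 2 * ‖(∑ i, A i (xk i)) - b‖ ^ 2 : ℝ) : EReal) :=
    hvE ▸ iInf_le _ (⟨xk, hxk⟩ : {z : ∀ i, EuclideanSpace ℝ (Fin (n i)) // ∀ i, z i ∈ Z i})
  refine (add_le_add_left hv _).trans_eq ?_
  rw [← EReal.coe_add, EReal.coe_eq_coe_iff, augL, mul_assoc 2 β θ, mul_comm β θ, ← hinner]
  ring
end
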